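/- In ℂ[λ₁,λ₂,μ₁,μ₂], let α, β, γ be the coefficient forms α = −λ₁³μ₁²μ₂ − λ₁²λ₂μ₂³ − λ₁λ₂²μ₁³ + λ₂³μ₁μ₂², β = −λ₁⁴μ₁μ₂³ + λ₁³λ₂μ₁⁴ + 3λ₁²λ₂²μ₁²μ₂² − λ₁λ₂³μ₂⁴ + λ₂⁴μ₁³μ₂, γ = −λ₁⁵(μ₁⁵ + μ₂⁵) + 10λ₁⁴λ₂μ₁³μ₂² − 10λ₁³λ₂²μ₁μ₂⁴ − 10λ₁²λ₂³μ₁⁴μ₂ − 10λ₁λ₂⁴μ₁²μ₂³ + λ₂⁵(μ₁⁵ − μ₂⁵), let f(z₁,z₂) = z₁z₂(z₁¹⁰ + 11z₁⁵z₂⁵ − z₂¹⁰), let M₁ = (λ₁¹³ − 39λ₁⁸λ₂⁵ − 26λ₁³λ₂¹⁰)μ₁ + (−26λ₁¹⁰λ₂³ + 39λ₁⁵λ₂⁸ + λ₂¹³)μ₂, and let D(α,β,γ) = 108α⁵γ − 135α⁴β² + 90α²βγ² − 320αβ³γ + 256β⁵ + γ⁴. Then (11α³β + 2β²γ − αγ²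 − 2·M₁·f(μ₁,μ₂))² = α²·D(α,β,γ). -/

import Mathlib

open MvPolynomial

namespace Stmt15

/-- Coefficient form `α` (variables `X 0 = λ₁`, `X 1 = λ₂`, `X 2 = μ₁`, `X 3 = μ₂`). -/
noncomputable def coeffA : MvPolynomial (Fin 4) ℂ :=
  -(X 0) ^ 3 * (X 2) ^ 2 * X 3 - (X 0) ^ 2 * X 1 * (X 3) ^ 3
    - X 0 * (X 1) ^ 2 * (X 2) ^ 3 + (X 1) ^ 3 * X 2 * (X 3) ^ 2

/-- Coefficient form `β`. -/
noncomputable def coeffB : MvPolynomial (Fin 4) ℂ :=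
  -(X 0) ^ 4 * X 2 * (X 3) ^ 3 + (X 0) ^ 3 * X 1 * (X 2) ^ 4
    + 3 * (X 0) ^ 2 * (X 1) ^ 2 * (X 2) ^ 2 * (X 3) ^ 2
    - X 0 * (X 1) ^ 3 * (X 3) ^ 4 + (X 1) ^ 4 * (X 2) ^ 3 * X 3

/-- Coefficient form `γ`. -/
noncomputable def coeffC : MvPolynomial (Fin 4) ℂ :=
  -(X 0) ^ 5 * ((X 2) ^ 5 + (X 3) ^ 5) + 10 * (X 0) ^ 4 * X 1 * (X 2) ^ 3 * (X 3) ^ 2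
    - 10 * (X 0) ^ 3 * (X 1) ^ 2 * X 2 * (X 3) ^ 4
    - 10 * (X 0) ^ 2 * (X 1) ^ 3 * (X 2) ^ 4 * X 3
    - 10 * X 0 * (X 1) ^ 4 * (X 2) ^ 2 * (X 3) ^ 3
    + (X 1) ^ 5 * ((X 2) ^ 5 - (X 3) ^ 5)

/-- `f₂ = f(μ₁,μ₂)`, the degree-12 icosahedral invariant in the `μ`-variables. -/
noncomputable def f₂ : MvPolynomial (Fin 4) ℂ :=
  X 2 * X 3 * ((X 2) ^ 10 + 11 * (X 2) ^ 5 * (X 3) ^ 5 - (X 3) ^ 10)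

/-- The invariant form `M₁`. -/
noncomputable def M₁ : MvPolynomial (Fin 4) ℂ :=
  ((X 0) ^ 13 - 39 * (X 0) ^ 8 * (X 1) ^ 5 - 26 * (X 0) ^ 3 * (X 1) ^ 10) * X 2
    + (-26 * (X 0) ^ 10 * (X 1) ^ 3 + 39 * (X 0) ^ 5 * (X 1) ^ 8 + (X 1) ^ 13) * X 3

/-- The discriminant polynomial `D(α,β,γ)`. -/
noncomputable def discD : MvPolynomial (Fin 4) ℂ :=
  108 * coeffA ^ 5 * coeffC - 135 * coeffA ^ 4 * coeffB ^ 2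
    + 90 * coeffA ^ 2 * coeffB * coeffC ^ 2 - 320 * coeffA * coeffB ^ 3 * coeffC
    + 256 * coeffB ^ 5 + coeffC ^ 4

set_option maxHeartbeats 0 in
set_option maxRecDepth 100000 in
/-- `(11α³β + 2β²γ − αγ² − 2M₁f₂)² = α²·D(α,β,γ)`, encoding
`M₁f₂ = (11α³β + 2β²γ − αγ²)/2 − ∇α/2`. -/
theorem M1f2_identity :
    (11 * coeffA ^ 3 * coeffB + 2 * coeffB ^ 2 * coeffC - coeffA * coeffC ^ 2
        - 2 * M₁ * f₂) ^ 2 = coeffA ^ 2 * discD := by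
  unfold discD coeffA coeffB coeffC M₁ f₂
  generalize (X 0 : MvPolynomial (Fin 4) ℂ) = a
  generalize (X 1 : MvPolynomial (Fin 4) ℂ) = b
  generalize (X 2 : MvPolynomial (Fin 4) ℂ) = c
  generalize (X 3 : MvPolynomial (Fin 4) ℂ) = d
  ring

end Stmt15
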